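/- arXiv:math/0210302 — 11 statements merged into one kernel-verified Lean document; each statement's English description precedes it below -/
import Mathlib

section
/- For every z in the closed interval [2π, 4π], setting y = z^{1/2}(4π − z), one has (1/π²)·[ ∫_0^y (36π − (27/2)·y^{2/3} − (9/2)·x^{2/3})^{−1/2} dx + ∫_y^{z^{3/2}} (36π − 9·y·x^{−1/3} − 9·x^{2/3})^{−1/2} dx ] ≤ 1. -/
open Real intervalIntegral

/-- Comparison after the substitution `x = (P * u) ^ 3`: a nonnegative integrand which is dominated
by the derivative of `H` in the variable `u` has integral at most the increment of `H`. -/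
theorem integral_le_sub_of_cube_subst {f H h : ℝ → ℝ} {P a b : ℝ} (hP : 0 < P) (ha : 0 ≤ a)
    (hab : a ≤ b) (hH : ContinuousOn H (Set.Icc a b))
    (hd : ∀ u ∈ Set.Ioo a b, HasDerivAt H (h u) u)
    (hf : ∀ u ∈ Set.Ioo a b, 0 ≤ f ((P * u) ^ 3))
    (hfh : ∀ u ∈ Set.Ioo a b, f ((P * u) ^ 3) * (3 * P ^ 3 * u ^ 2) ≤ h u) :
    ∫ x in (P * a) ^ 3..(P * b) ^ 3, f x ≤ H b - H a := by
  have root : ∀ u : ℝ, 0 ≤ u → ((P * u) ^ 3) ^ ((1:ℝ) / 3) / P = u := fun u hu => by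
    rw [← rpow_natCast, ← rpow_mul (by positivity)]
    norm_num
    field_simp
  have cube : ∀ x : ℝ, 0 ≤ x → (P * (x ^ ((1:ℝ) / 3) / P)) ^ 3 = x := fun x hx => by
    rw [mul_div_cancel₀ _ hP.ne', ← rpow_natCast, ← rpow_mul hx]
    norm_num
  have hA : 0 ≤ (P * a) ^ 3 := by positivity
  have hAB : (P * a) ^ 3 ≤ (P * b) ^ 3 := by gcongr
  set φ : ℝ → ℝ := fun x => x ^ ((1:ℝ) / 3) / P with hφ
  have hφc : Continuous φ := (continuous_rpow_const (by norm_num)).div_const P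
  have maps : ∀ x ∈ Set.Icc ((P * a) ^ 3) ((P * b) ^ 3), φ x ∈ Set.Icc a b := fun x hx => by
    have hb := ha.trans hab
    refine ⟨?_, ?_⟩
    · rw [← root a ha]
      exact div_le_div_of_nonneg_right (rpow_le_rpow hA hx.1 (by norm_num)) hP.le
    · rw [← root b hb]
      exact div_le_div_of_nonneg_right (rpow_le_rpow (hA.trans hx.1) hx.2 (by norm_num)) hP.le
  have maps' : ∀ x ∈ Set.Ioo ((P * a) ^ 3) ((P * b) ^ 3), φ x ∈ Set.Ioo a b := fun x hx => by
    have hb := ha.trans hab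
    refine ⟨?_, ?_⟩
    · rw [← root a ha]
      exact div_lt_div_of_pos_right (rpow_lt_rpow hA hx.1 (by norm_num)) hP
    · rw [← root b hb]
      exact div_lt_div_of_pos_right (rpow_lt_rpow (hA.trans hx.1.le) hx.2 (by norm_num)) hP
  have hcont : ContinuousOn (H ∘ φ) (Set.Icc ((P * a) ^ 3) ((P * b) ^ 3)) :=
    hH.comp hφc.continuousOn maps
  have hder : ∀ x ∈ Set.Ioo ((P * a) ^ 3) ((P * b) ^ 3),
      HasDerivAt (H ∘ φ) (h (φ x) * (1 / (3 * P ^ 3 * φ x ^ 2))) x := fun x hx => by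
    have hx0 : 0 < x := hA.trans_lt hx.1
    refine (hd _ (maps' x hx)).comp x ?_
    have h1 := (hasDerivAt_rpow_const (x := x) (p := (1:ℝ) / 3) (Or.inl hx0.ne')).div_const P
    refine h1.congr_deriv ?_
    have h2 : x ^ ((1:ℝ) / 3 - 1) = ((x ^ ((1:ℝ) / 3)) ^ 2)⁻¹ := by
      rw [← rpow_natCast, ← rpow_mul hx0.le, ← rpow_neg hx0.le]
      norm_num
    have h3 : 0 < x ^ ((1:ℝ) / 3) := rpow_pos_of_pos hx0 _
    rw [h2, hφ]
    field_simp
  have hle : ∀ x ∈ Set.Ioo ((P * a) ^ 3) ((P * b) ^ 3),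
      0 ≤ f x ∧ f x ≤ h (φ x) * (1 / (3 * P ^ 3 * φ x ^ 2)) := fun x hx => by
    have hx0 : 0 < x := hA.trans_lt hx.1
    have hu := maps' x hx
    have hu0 : 0 < φ x := ha.trans_lt hu.1
    have h1 := hf _ hu
    have h2 := hfh _ hu
    have h3 : (P * φ x) ^ 3 = x := cube x hx0.le
    rw [h3] at h1 h2
    refine ⟨h1, ?_⟩
    rw [mul_one_div, le_div_iff₀ (by positivity)]
    exact h2
  have hint := integrableOn_deriv_of_nonneg hcont hder
    fun x hx => (hle x hx).1.trans (hle x hx).2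
  have hFTC := integral_eq_sub_of_hasDerivAt_of_le hAB hcont hder
    ((intervalIntegrable_iff_integrableOn_Ioc_of_le hAB).2 hint)
  have e1 : φ ((P * a) ^ 3) = a := root a ha
  have e2 : φ ((P * b) ^ 3) = b := root b (ha.trans hab)
  simp only [Function.comp, e1, e2] at hFTC
  rw [← hFTC, integral_of_le hAB, integral_of_le hAB, MeasureTheory.integral_Ioc_eq_integral_Ioo,
    MeasureTheory.integral_Ioc_eq_integral_Ioo]
  refine MeasureTheory.integral_mono_of_nonneg ?_ (hint.mono_set Set.Ioo_subset_Ioc_self) ?_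
  · filter_upwards [MeasureTheory.ae_restrict_mem measurableSet_Ioo] with x hx using (hle x hx).1
  · filter_upwards [MeasureTheory.ae_restrict_mem measurableSet_Ioo] with x hx using (hle x hx).2

theorem rpow_neg_half_le {A B : ℝ} (hA : 0 < A) (hB : 0 ≤ B) (h : 1 ≤ A * B ^ 2) :
    A ^ (-(1:ℝ) / 2) ≤ B := by
  have h1 : A ^ (-(1:ℝ) / 2) = (√A)⁻¹ := by
    rw [sqrt_eq_rpow, ← rpow_neg hA.le]
    norm_num
  have h2 : 0 < √A := sqrt_pos.2 hA
  rw [h1, inv_le_iff_one_le_mul₀ h2]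
  refine le_of_sq_le_sq ?_ (by positivity)
  rw [mul_pow, sq_sqrt hA.le]
  linarith

theorem hasDerivAt_sqrt_one_sub_sq {u : ℝ} (h0 : -1 < u) (h1 : u < 1) :
    HasDerivAt (fun u : ℝ => √(1 - u ^ 2)) (-u / √(1 - u ^ 2)) u := by
  have h : 0 < 1 - u ^ 2 := by nlinarith
  have h2 := ((hasDerivAt_pow 2 u).const_sub 1).sqrt h.ne'
  refine h2.congr_deriv ?_
  have := sqrt_pos.2 h
  field_simp
  norm_num

theorem hasDerivAt_arcsin_sub_mul_sqrt {u : ℝ} (h0 : -1 < u) (h1 : u < 1) :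
    HasDerivAt (fun u : ℝ => (arcsin u - u * √(1 - u ^ 2)) / 2) (u ^ 2 / √(1 - u ^ 2)) u := by
  have h : 0 < 1 - u ^ 2 := by nlinarith
  have hs := sqrt_pos.2 h
  have h2 := ((hasDerivAt_arcsin h0.ne' h1.ne).sub
    ((hasDerivAt_id u).mul (hasDerivAt_sqrt_one_sub_sq h0 h1))).div_const 2
  refine h2.congr_deriv ?_
  simp only [id]
  field_simp
  rw [sq_sqrt h.le]
  ring

theorem sub_sin_mul_cos_le {θ : ℝ} (h0 : 0 ≤ θ) (h1 : θ ≤ π / 2) :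
    θ - sin θ * cos θ ≤ sin θ ^ 3 * (2 + θ - cos θ) := by
  have hd : ∀ t : ℝ, HasDerivAt
      (fun t => sin t ^ 3 * (2 + t - cos t) - (t - sin t * cos t))
      (3 * sin t ^ 2 * cos t * (2 + t - cos t) + sin t ^ 3 * (1 + sin t)
        - (1 - (cos t * cos t + sin t * (-sin t)))) t := fun t => by
    have := (((hasDerivAt_sin t).pow 3).mul
      (((hasDerivAt_id t).const_add 2).sub (hasDerivAt_cos t))).sub
      ((hasDerivAt_id t).sub ((hasDerivAt_sin t).mul (hasDerivAt_cos t)))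
    refine this.congr_deriv ?_
    simp
  have hm : MonotoneOn (fun t => sin t ^ 3 * (2 + t - cos t) - (t - sin t * cos t))
      (Set.Icc 0 (π / 2)) := by
    refine monotoneOn_of_hasDerivWithinAt_nonneg (convex_Icc _ _)
      (fun t _ => (hd t).continuousAt.continuousWithinAt)
      (fun t _ => (hd t).hasDerivWithinAt) fun t ht => ?_
    rw [interior_Icc] at ht
    have hs : 0 < sin t := sin_pos_of_pos_of_lt_pi ht.1 (by linarith [ht.2, pi_pos])
    have hc : 0 < cos t := cos_pos_of_mem_Ioo ⟨by linarith [ht.1, pi_pos], ht.2⟩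
    have hst : sin t < t := sin_lt ht.1
    have hsc := sin_sq_add_cos_sq t
    have hc1 := cos_le_one t
    have key : 0 ≤ 3 * cos t * (2 + t - cos t) + sin t * (1 + sin t) - 2 := by
      have h1 : 3 * cos t * (1 + sin t) ≤ 3 * cos t * (2 + t - cos t) := by
        gcongr
        linarith
      nlinarith [mul_pos hs hc]
    nlinarith [mul_nonneg (sq_nonneg (sin t)) key]
  have := hm ⟨le_rfl, by positivity⟩ ⟨h0, h1⟩ h0
  simp at this
  linarith

theorem arcsin_sub_mul_sqrt_le {p : ℝ} (h0 : 0 ≤ p) (h1 : p ≤ 1) :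
    arcsin p - p * √(1 - p ^ 2) ≤ p ^ 3 * (2 + arcsin p - √(1 - p ^ 2)) := by
  have := sub_sin_mul_cos_le (arcsin_nonneg.2 h0) (arcsin_le_pi_div_two p)
  rwa [sin_arcsin (by linarith) h1, cos_arcsin] at this

theorem cube_rpow_two_thirds {t : ℝ} (ht : 0 ≤ t) : (t ^ 3) ^ ((2:ℝ) / 3) = t ^ 2 := by
  rw [← rpow_natCast, ← rpow_mul ht, ← rpow_natCast]
  norm_num

theorem cube_rpow_neg_third {t : ℝ} (ht : 0 ≤ t) : (t ^ 3) ^ (-(1:ℝ) / 3) = t⁻¹ := by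
  rw [← rpow_natCast, ← rpow_mul ht, ← rpow_neg_one]
  norm_num

theorem integral_inner_le {P p : ℝ} (hP : 0 < P) (hp0 : 0 ≤ p) (hp1 : p ≤ 1) :
    ∫ x in (0:ℝ)..(P * p) ^ 3, (9 * P ^ 2 * (1 + p ^ 3) - (27 / 2) * (P * p) ^ 2
      - (9 / 2) * x ^ ((2:ℝ) / 3)) ^ (-(1:ℝ) / 2)
      ≤ 1.42 * P ^ 2 * ((arcsin p - p * √(1 - p ^ 2)) / 2) := by
  have main := integral_le_sub_of_cube_subst
    (f := fun x => (9 * P ^ 2 * (1 + p ^ 3) - (27 / 2) * (P * p) ^ 2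
      - (9 / 2) * x ^ ((2:ℝ) / 3)) ^ (-(1:ℝ) / 2))
    (H := fun u => 1.42 * P ^ 2 * ((arcsin u - u * √(1 - u ^ 2)) / 2))
    (h := fun u => 1.42 * P ^ 2 * (u ^ 2 / √(1 - u ^ 2))) hP le_rfl hp0
    (by fun_prop)
    (fun u hu => (hasDerivAt_arcsin_sub_mul_sqrt (by linarith [hu.1])
      (by linarith [hu.2])).const_mul _) ?_ ?_
  · simpa using main
  all_goals
    intro u hu
    obtain ⟨hu0, hup⟩ := hu
    have hs : 0 < 1 - u ^ 2 := by nlinarith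
    have hq := sqrt_pos.2 hs
    have hA : 9 / 2 * P ^ 2 * (1 - u ^ 2) ≤
        9 * P ^ 2 * (1 + p ^ 3) - (27 / 2) * (P * p) ^ 2 - (9 / 2) * (P * u) ^ 2 := by
      have h1 : 0 ≤ (1 - p) ^ 2 * (1 + 2 * p) := by positivity
      nlinarith [mul_nonneg (sq_nonneg P) h1]
    have hA0 : 0 < 9 / 2 * P ^ 2 * (1 - u ^ 2) := by positivity
    simp only [cube_rpow_two_thirds (mul_pos hP hu0).le]
  · exact rpow_nonneg (hA0.le.trans hA) _
  · have hB := rpow_neg_half_le (B := 1.42 / (3 * P * √(1 - u ^ 2))) (hA0.trans_le hA)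
      (by positivity) (by
        refine le_trans ?_ (mul_le_mul_of_nonneg_right hA (sq_nonneg _))
        rw [div_pow, mul_pow, sq_sqrt hs.le]
        field_simp
        norm_num)
    refine (mul_le_mul_of_nonneg_right hB (by positivity)).trans_eq ?_
    field_simp

theorem integral_outer_le {P p : ℝ} (hP : 0 < P) (hp0 : 0 ≤ p) (hp1 : p ≤ 1) :
    ∫ x in (P * p) ^ 3..P ^ 3, (9 * P ^ 2 * (1 + p ^ 3) - 9 * (P * p) ^ 3 * x ^ (-(1:ℝ) / 3)
      - 9 * x ^ ((2:ℝ) / 3)) ^ (-(1:ℝ) / 2)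
      ≤ P ^ 2 * (π / 4 - (arcsin p - p * √(1 - p ^ 2)) / 2
        + 0.21 * p ^ 3 * (π / 2 - arcsin p + √(1 - p ^ 2))) := by
  have main := integral_le_sub_of_cube_subst
    (f := fun x => (9 * P ^ 2 * (1 + p ^ 3) - 9 * (P * p) ^ 3 * x ^ (-(1:ℝ) / 3)
      - 9 * x ^ ((2:ℝ) / 3)) ^ (-(1:ℝ) / 2))
    (H := fun u => P ^ 2 * ((arcsin u - u * √(1 - u ^ 2)) / 2
      + 0.21 * p ^ 3 * (arcsin u - √(1 - u ^ 2))))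
    (h := fun u => P ^ 2 * (u ^ 2 / √(1 - u ^ 2)
      + 0.21 * p ^ 3 * (1 / √(1 - u ^ 2) - -u / √(1 - u ^ 2)))) hP hp0 hp1
    (by fun_prop)
    (fun u hu => ?_) ?_ ?_
  · rw [mul_one] at main
    refine main.trans_eq ?_
    simp
    ring
  · have h0 : -1 < u := by linarith [hu.1]
    exact ((hasDerivAt_arcsin_sub_mul_sqrt h0 hu.2).add
      (((hasDerivAt_arcsin h0.ne' hu.2.ne).sub
        (hasDerivAt_sqrt_one_sub_sq h0 hu.2)).const_mul _)).const_mul _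
  all_goals
    intro u hu
    obtain ⟨hup, hu1⟩ := hu
    have hu0 : 0 < u := hp0.trans_lt hup
    have hs : 0 < 1 - u ^ 2 := by nlinarith
    have hq := sqrt_pos.2 hs
    simp only [cube_rpow_two_thirds (mul_pos hP hu0).le, cube_rpow_neg_third (mul_pos hP hu0).le]
    obtain ⟨x, hx⟩ : ∃ x, x = p ^ 3 / (u * (1 + u)) := ⟨_, rfl⟩
    have hx0 : 0 ≤ x := by rw [hx]; positivity
    have hx1 : x ≤ 1 / 2 := by
      have h1 : p ^ 3 ≤ u ^ 3 := by gcongr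
      rw [hx, div_le_iff₀ (by positivity)]
      nlinarith [mul_pos hu0 (sub_pos.2 hu1), mul_pos (mul_pos hu0 hu0) (sub_pos.2 hu1)]
    have hA : 9 * P ^ 2 * (1 + p ^ 3) - 9 * (P * p) ^ 3 * (P * u)⁻¹ - 9 * (P * u) ^ 2
        = 9 * P ^ 2 * (1 - u ^ 2) * (1 - x) := by
      rw [hx]
      field_simp
      ring
    have hA0 : 0 < 9 * P ^ 2 * (1 - u ^ 2) * (1 - x) :=
      mul_pos (by positivity) (by linarith)
    rw [hA]
  · exact rpow_nonneg hA0.le _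
  · have hB := rpow_neg_half_le (B := (1 + 0.84 * x) / (3 * P * √(1 - u ^ 2))) hA0
      (by positivity) (by
        have h1 : 1 ≤ (1 - x) * (1 + 0.84 * x) ^ 2 := by
          have : 0 ≤ 0.68 - 0.9744 * x - 0.7056 * x ^ 2 := by nlinarith
          nlinarith [mul_nonneg hx0 this]
        rw [div_pow, mul_pow, sq_sqrt hs.le]
        refine h1.trans_eq ?_
        field_simp
        norm_num)
    refine (mul_le_mul_of_nonneg_right hB (by positivity)).trans ?_
    have hxu : u ^ 2 * x ≤ p ^ 3 * (1 + u) / 4 := by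
      have h1 : u ^ 2 * x = p ^ 3 * (u / (1 + u)) := by
        rw [hx]
        field_simp
      have h2 : u / (1 + u) ≤ (1 + u) / 4 := by
        rw [div_le_iff₀ (by positivity)]
        nlinarith [sq_nonneg (1 - u)]
      rw [h1, mul_div_assoc]
      gcongr
    calc (1 + 0.84 * x) / (3 * P * √(1 - u ^ 2)) * (3 * P ^ 3 * u ^ 2)
        = P ^ 2 * (u ^ 2 + 0.84 * (u ^ 2 * x)) / √(1 - u ^ 2) := by field_simp
      _ ≤ P ^ 2 * (u ^ 2 + 0.84 * (p ^ 3 * (1 + u) / 4)) / √(1 - u ^ 2) := by gcongr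
      _ = _ := by
        field_simp
        ring

theorem bray_alpha_half_le_one :
    ∀ z ∈ Set.Icc (2 * Real.pi) (4 * Real.pi),
      (1 / Real.pi ^ 2) *
        ((∫ x in (0:ℝ)..(Real.sqrt z * (4 * Real.pi - z)),
            (36 * Real.pi - (27 / 2) * (Real.sqrt z * (4 * Real.pi - z)) ^ ((2:ℝ)/3)
              - (9 / 2) * x ^ ((2:ℝ)/3)) ^ (-(1:ℝ)/2))
         + (∫ x in (Real.sqrt z * (4 * Real.pi - z))..(z ^ ((3:ℝ)/2)),
            (36 * Real.pi - 9 * (Real.sqrt z * (4 * Real.pi - z)) * x ^ (-(1:ℝ)/3)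
              - 9 * x ^ ((2:ℝ)/3)) ^ (-(1:ℝ)/2))) ≤ 1 := by
  rintro z ⟨hz1, hz2⟩
  have hz : 0 < z := by linarith [pi_pos]
  have hP : 0 < √z := sqrt_pos.2 hz
  have hPz : √z ^ 2 = z := sq_sqrt hz.le
  have hw0 : 0 ≤ (4 * π - z) / z := div_nonneg (by linarith) hz.le
  have hw1 : (4 * π - z) / z ≤ 1 := by
    rw [div_le_one hz]
    linarith
  obtain ⟨p, hp⟩ : ∃ p, p = ((4 * π - z) / z) ^ ((1:ℝ) / 3) := ⟨_, rfl⟩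
  have hp0 : 0 ≤ p := hp ▸ rpow_nonneg hw0 _
  have hp1 : p ≤ 1 := hp ▸ rpow_le_one hw0 hw1 (by norm_num)
  have hp3 : p ^ 3 = (4 * π - z) / z := by
    rw [hp, ← rpow_natCast, ← rpow_mul hw0]
    norm_num
  have hπ : 9 * √z ^ 2 * (1 + p ^ 3) = 36 * π := by
    rw [hPz, hp3]
    field_simp
    ring
  have hy : √z * (4 * π - z) = (√z * p) ^ 3 := by
    have h1 : (√z * p) ^ 3 = √z * (√z ^ 2 * p ^ 3) := by ring
    rw [h1, hPz, hp3]
    field_simp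
  have hz3 : z ^ ((3:ℝ) / 2) = √z ^ 3 := by
    rw [sqrt_eq_rpow, ← rpow_natCast, ← rpow_mul hz.le]
    norm_num
  have h1 := integral_inner_le hP hp0 hp1
  have h2 := integral_outer_le hP hp0 hp1
  rw [hπ] at h1 h2
  rw [hy, hz3, cube_rpow_two_thirds (by positivity), one_div, inv_mul_le_iff₀ (by positivity)]
  refine (add_le_add h1 h2).trans ?_
  have key := arcsin_sub_mul_sqrt_le hp0 hp1
  have hπ3 : p ^ 3 * 2 ≤ p ^ 3 * (0.69 * π) := by
    gcongr
    linarith [pi_gt_three]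
  have bound : 0.42 * ((arcsin p - p * √(1 - p ^ 2)) / 2) + π / 4
      + 0.21 * p ^ 3 * (π / 2 - arcsin p + √(1 - p ^ 2)) ≤ π / 4 * (1 + p ^ 3) := by
    nlinarith [pow_nonneg hp0 3, pi_pos]
  calc _ = √z ^ 2 * (0.42 * ((arcsin p - p * √(1 - p ^ 2)) / 2) + π / 4
      + 0.21 * p ^ 3 * (π / 2 - arcsin p + √(1 - p ^ 2))) := by ring
    _ ≤ √z ^ 2 * (π / 4 * (1 + p ^ 3)) := by gcongr
    _ = π ^ 2 * 1 := by linear_combination π / 36 * hπ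
end

section
/- Let β ∈ (0, 1] and set m = (arcsin β − β)/β³. Then for every x ∈ [0, β], arcsin x ≤ x + m·x³. -/
/-- Huygens' inequality. -/
theorem three_mul_le_two_mul_sin_add_tan {t : ℝ} (h0 : 0 ≤ t) (ht : t < Real.pi / 2) :
    3 * t ≤ 2 * Real.sin t + Real.tan t := by
  have hcos : ∀ y ∈ Set.Ico (0 : ℝ) (Real.pi / 2), 0 < Real.cos y := fun y hy =>
    Real.cos_pos_of_mem_Ioo ⟨by linarith [hy.1, Real.pi_pos], hy.2⟩
  have hderiv : ∀ y ∈ Set.Ico (0 : ℝ) (Real.pi / 2),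
      HasDerivAt (fun y => 2 * Real.sin y + Real.tan y - 3 * y)
        (2 * Real.cos y + 1 / Real.cos y ^ 2 - 3 * 1) y := fun y hy =>
    (((Real.hasDerivAt_sin y).const_mul 2).add (Real.hasDerivAt_tan (hcos y hy).ne')).sub
      ((hasDerivAt_id y).const_mul 3)
  have hmono : MonotoneOn (fun y => 2 * Real.sin y + Real.tan y - 3 * y)
      (Set.Ico 0 (Real.pi / 2)) := by
    refine monotoneOn_of_deriv_nonneg (convex_Ico _ _)
      (fun y hy => (hderiv y hy).continuousAt.continuousWithinAt)
      (fun y hy => (hderiv y (interior_subset hy)).differentiableAt.differentiableWithinAt)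
      fun y hy => ?_
    have hy := interior_subset hy
    rw [(hderiv y hy).deriv]
    have hc := hcos y hy
    have hfactor : 2 * Real.cos y + 1 / Real.cos y ^ 2 - 3 * 1 =
        (Real.cos y - 1) ^ 2 * (2 * Real.cos y + 1) / Real.cos y ^ 2 := by
      field_simp
      ring
    rw [hfactor]
    positivity
  have := hmono ⟨le_rfl, h0.trans_lt ht⟩ ⟨h0, ht⟩ h0
  simp only [Real.sin_zero, Real.tan_zero, mul_zero, add_zero, sub_zero] at this
  linarith

theorem monotoneOn_sub_sin_div_sin_pow_three :
    MonotoneOn (fun t => (t - Real.sin t) / Real.sin t ^ 3) (Set.Ioc 0 (Real.pi / 2)) := by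
  have hsin : ∀ t ∈ Set.Ioc (0 : ℝ) (Real.pi / 2), 0 < Real.sin t := fun t ht =>
    Real.sin_pos_of_pos_of_lt_pi ht.1 (by linarith [ht.2, Real.pi_pos])
  have hderiv : ∀ t ∈ Set.Ioc (0 : ℝ) (Real.pi / 2),
      HasDerivAt (fun t => (t - Real.sin t) / Real.sin t ^ 3)
        (((1 - Real.cos t) * Real.sin t ^ 3 -
          (t - Real.sin t) * ((3 : ℕ) * Real.sin t ^ (3 - 1) * Real.cos t)) /
            (Real.sin t ^ 3) ^ 2) t := fun t ht =>
    ((hasDerivAt_id t).sub (Real.hasDerivAt_sin t)).div ((Real.hasDerivAt_sin t).pow 3)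
      (pow_pos (hsin t ht) 3).ne'
  refine monotoneOn_of_deriv_nonneg (convex_Ioc _ _)
    (fun t ht => (hderiv t ht).continuousAt.continuousWithinAt)
    (fun t ht => (hderiv t (interior_subset ht)).differentiableAt.differentiableWithinAt)
    fun t ht => ?_
  rw [(hderiv t (interior_subset ht)).deriv]
  rw [interior_Ioc] at ht
  have hc : 0 < Real.cos t :=
    Real.cos_pos_of_mem_Ioo ⟨by linarith [ht.1, Real.pi_pos], ht.2⟩
  have hH := mul_le_mul_of_nonneg_right
    (three_mul_le_two_mul_sin_add_tan ht.1.le ht.2) hc.le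
  rw [add_mul, Real.tan_mul_cos hc.ne'] at hH
  have hnum : (1 - Real.cos t) * Real.sin t ^ 3 -
      (t - Real.sin t) * ((3 : ℕ) * Real.sin t ^ (3 - 1) * Real.cos t) =
      Real.sin t ^ 2 *
        (2 * Real.sin t * Real.cos t + Real.sin t - 3 * t * Real.cos t) := by
    norm_num
    ring
  rw [hnum]
  exact div_nonneg (mul_nonneg (sq_nonneg _) (sub_nonneg.2 hH)) (sq_nonneg _)

theorem arcsin_le_cubic (β : ℝ) (hβ : β ∈ Set.Ioc (0:ℝ) 1) :
    ∀ x ∈ Set.Icc (0:ℝ) β,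
      Real.arcsin x ≤ x + ((Real.arcsin β - β) / β ^ 3) * x ^ 3 := by
  rintro x ⟨hx0, hxβ⟩
  rcases hx0.eq_or_lt with rfl | hx
  · simp
  have h := monotoneOn_sub_sin_div_sin_pow_three
    ⟨Real.arcsin_pos.2 hx, Real.arcsin_le_pi_div_two x⟩
    ⟨Real.arcsin_pos.2 hβ.1, Real.arcsin_le_pi_div_two β⟩
    (Real.monotone_arcsin hxβ)
  simp only [Real.sin_arcsin (by linarith : -1 ≤ x) (hxβ.trans hβ.2),
    Real.sin_arcsin (by linarith [hβ.1] : -1 ≤ β) hβ.2] at h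
  rw [div_le_iff₀ (pow_pos hx 3)] at h
  linarith
end

section
/- For every φ in the closed interval [0, 2/5], E(φ) ≤ 1 + (1/2)·φ⁴. -/
noncomputable def E (φ : ℝ) : ℝ :=
  Real.sqrt (1 + φ) / Real.sqrt (1 + φ - φ ^ 2) - (1 / 2) * φ ^ 2 / (1 + φ)

theorem one_le_sq_mul_one_sub {t : ℝ} (h0 : 0 ≤ t) (h1 : t ≤ 1 / 5) :
    1 ≤ (1 + t / 2 + t ^ 2 / 2) ^ 2 * (1 - t) := by
  have h2 : t ^ 2 ≤ (1 / 5) ^ 2 := by gcongr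
  have h3 : t ^ 3 ≤ (1 / 5) ^ 3 := by gcongr
  have h : 0 ≤ 1 - 3 * t - t ^ 2 - t ^ 3 := by linarith
  nlinarith [mul_nonneg (sq_nonneg t) h]

theorem E_le_on_first (φ : ℝ) (hφ : φ ∈ Set.Icc (0:ℝ) (2/5)) :
    E φ ≤ 1 + (1 / 2) * φ ^ 4 := by
  obtain ⟨h0, h1⟩ := hφ
  have hp : 0 < 1 + φ := by linarith
  have hq : 0 < 1 + φ - φ ^ 2 := by nlinarith
  obtain ⟨t, ht⟩ : ∃ t, t = φ ^ 2 / (1 + φ) := ⟨_, rfl⟩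
  have ht0 : 0 ≤ t := by rw [ht]; positivity
  have ht1 : t ≤ 1 / 5 := by rw [ht, div_le_iff₀ hp]; nlinarith
  have htφ : t ≤ φ ^ 2 := by rw [ht]; exact div_le_self (sq_nonneg φ) (by linarith)
  have ht4 : t ^ 2 ≤ φ ^ 4 := by
    calc t ^ 2 ≤ (φ ^ 2) ^ 2 := by gcongr
      _ = φ ^ 4 := by ring
  have hfac : 1 + φ - φ ^ 2 = (1 + φ) * (1 - t) := by rw [ht]; field_simp
  have hsqrt : √(1 + φ) / √(1 + φ - φ ^ 2) ≤ 1 + t / 2 + t ^ 2 / 2 := by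
    rw [← Real.sqrt_div hp.le]
    refine Real.sqrt_le_iff.mpr ⟨by positivity, ?_⟩
    rw [div_le_iff₀ hq, hfac]
    nlinarith [mul_le_mul_of_nonneg_left (one_le_sq_mul_one_sub ht0 ht1) hp.le]
  have hE : E φ = √(1 + φ) / √(1 + φ - φ ^ 2) - t / 2 := by
    rw [E, ht]; ring
  rw [hE]
  linarith
end

section
/- For every φ in the closed interval [0, 4/5], F(φ) ≤ π/4 − (1/3)·φ³. -/
noncomputable def F (φ : ℝ) : ℝ :=
  Real.pi / 4 + (1 / 2) * φ * Real.sqrt (1 - φ ^ 2) - (1 / 2) * Real.arcsin φ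

theorem monotone_sub_sin_mul_cos_sub_sin_cube :
    Monotone fun t : ℝ => t - Real.sin t * Real.cos t - 2 / 3 * Real.sin t ^ 3 := by
  have hderiv (t : ℝ) :
      HasDerivAt (fun t : ℝ => t - Real.sin t * Real.cos t - 2 / 3 * Real.sin t ^ 3)
        (2 * Real.sin t ^ 2 * (1 - Real.cos t)) t := by
    refine HasDerivAt.congr_deriv (((hasDerivAt_id t).sub
      ((Real.hasDerivAt_sin t).mul (Real.hasDerivAt_cos t))).sub (((Real.hasDerivAt_sin t).pow 3).const_mul
        (2 / 3))) ?_
    push_cast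
    linear_combination -Real.sin_sq_add_cos_sq t
  refine monotone_of_deriv_nonneg (fun t => (hderiv t).differentiableAt) fun t => ?_
  rw [(hderiv t).deriv]
  exact mul_nonneg (by positivity) (sub_nonneg.2 (Real.cos_le_one t))

theorem F_le (φ : ℝ) (hφ : φ ∈ Set.Icc (0:ℝ) (4/5)) :
    F φ ≤ Real.pi / 4 - (1 / 3) * φ ^ 3 := by
  obtain ⟨h0, h1⟩ := hφ
  have h := monotone_sub_sin_mul_cos_sub_sin_cube (Real.arcsin_nonneg.2 h0)
  simp only [Real.sin_zero, Real.cos_arcsin,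
    Real.sin_arcsin (by linarith : -1 ≤ φ) (by linarith : φ ≤ 1)] at h
  unfold F
  linarith
end

section
/- For every φ in the closed interval [0, 4/5], G(φ) ≤ π/4 − 1/2. -/
noncomputable def G (φ : ℝ) : ℝ :=
  Real.pi / 4 - (1 / 2) * Real.sqrt ((1 - φ) / (1 + φ)) - (1 / 2) * Real.arcsin φ

theorem one_sub_le_sqrt_one_sub_div_one_add {x : ℝ} (h0 : 0 ≤ x) (h1 : x ≤ 1) :
    1 - x ≤ Real.sqrt ((1 - x) / (1 + x)) := by
  apply Real.le_sqrt_of_sq_le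
  rw [le_div_iff₀ (by linarith)]
  nlinarith [mul_nonneg (sub_nonneg.2 h1) (sq_nonneg x)]

theorem le_arcsin_of_nonneg {x : ℝ} (h0 : 0 ≤ x) (h1 : x ≤ 1) : x ≤ Real.arcsin x := by
  rw [Real.le_arcsin_iff_sin_le ⟨by linarith [Real.pi_pos], by linarith [Real.pi_gt_three]⟩
    ⟨by linarith, h1⟩]
  exact Real.sin_le h0

theorem G_le (φ : ℝ) (hφ : φ ∈ Set.Icc (0:ℝ) (4/5)) :
    G φ ≤ Real.pi / 4 - 1 / 2 := by
  obtain ⟨h0, h1⟩ := hφ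
  have hsqrt := one_sub_le_sqrt_one_sub_div_one_add h0 (by linarith)
  have harcsin := le_arcsin_of_nonneg h0 (by linarith)
  unfold G
  linarith
end

section
/- For every φ in the closed interval [0, 4/5], I₁(φ) ≤ (4/π)·(1/(1+φ³))·(61/100)·φ³. -/
noncomputable def I₁ (φ : ℝ) : ℝ :=
  (4 / Real.pi) * (1 / (1 + φ ^ 3)) * (Real.sqrt 2 / 2) *
    ((2 + 2 * φ ^ 3 - 3 * φ ^ 2) *
        Real.arcsin (φ / Real.sqrt (2 + 2 * φ ^ 3 - 3 * φ ^ 2))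
      - φ * Real.sqrt (2 + 2 * φ ^ 3 - 4 * φ ^ 2))

theorem hasDerivAt_arcsin_sub_mul_sqrt_s9 {x : ℝ} (h₀ : -1 < x) (h₁ : x < 1) :
    HasDerivAt (fun s => Real.arcsin s - s * Real.sqrt (1 - s ^ 2))
      (2 * x ^ 2 / Real.sqrt (1 - x ^ 2)) x := by
  have hpos : 0 < 1 - x ^ 2 := by nlinarith
  have hsq := Real.sq_sqrt hpos.le
  have hs := Real.sqrt_pos.mpr hpos
  have hroot := (((hasDerivAt_id x).pow 2).const_sub 1).sqrt hpos.ne'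
  have h := (Real.hasDerivAt_arcsin h₀.ne' h₁.ne).sub ((hasDerivAt_id x).mul hroot)
  refine h.congr_deriv ?_
  simp only [id, Pi.pow_apply]
  field_simp
  rw [hsq]
  push_cast
  ring

theorem one_div_sqrt_one_sub_le {u : ℝ} (h₀ : 0 ≤ u) (h₁ : u ≤ 58 / 100) :
    1 / Real.sqrt (1 - u) ≤ 1 + 94 / 100 * u := by
  have hpos : 0 < 1 - u := by linarith
  rw [div_le_iff₀ (Real.sqrt_pos.mpr hpos), ← div_le_iff₀' (by positivity)]
  apply Real.le_sqrt_of_sq_le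
  rw [div_pow, div_le_iff₀ (by positivity)]
  have hquad : 0 ≤ 88 / 100 - 9964 / 10000 * u - 8836 / 10000 * u ^ 2 := by nlinarith
  nlinarith [mul_nonneg h₀ hquad]

theorem arcsin_sub_mul_sqrt_le_s9 {s : ℝ} (h₀ : 0 ≤ s) (h₁ : s ^ 2 ≤ 58 / 100) :
    Real.arcsin s - s * Real.sqrt (1 - s ^ 2) ≤ 2 / 3 * s ^ 3 + 376 / 1000 * s ^ 5 := by
  have hs : s < 1 := by nlinarith
  have hmono : MonotoneOn (fun x : ℝ => (2 / 3 * x ^ 3 + 376 / 1000 * x ^ 5) -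
      (Real.arcsin x - x * Real.sqrt (1 - x ^ 2))) (Set.Icc 0 s) := by
    refine monotoneOn_of_hasDerivWithinAt_nonneg (convex_Icc 0 s)
      (f' := fun x => (2 * x ^ 2 + 188 / 100 * x ^ 4) - 2 * x ^ 2 / Real.sqrt (1 - x ^ 2))
      (by fun_prop) ?_ ?_
    · intro x hx
      rw [interior_Icc] at hx
      have hpoly : HasDerivAt (fun x : ℝ => 2 / 3 * x ^ 3 + 376 / 1000 * x ^ 5)
          (2 * x ^ 2 + 188 / 100 * x ^ 4) x := by
        refine (((hasDerivAt_pow 3 x).const_mul (2 / 3)).add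
          ((hasDerivAt_pow 5 x).const_mul (376 / 1000))).congr_deriv ?_
        norm_num
        ring
      exact (hpoly.sub (hasDerivAt_arcsin_sub_mul_sqrt_s9
        (by linarith [hx.1]) (hx.2.trans hs))).hasDerivWithinAt
    · intro x hx
      rw [interior_Icc] at hx
      have hx2 : x ^ 2 ≤ 58 / 100 := by nlinarith [hx.1, hx.2]
      have h := mul_le_mul_of_nonneg_left (one_div_sqrt_one_sub_le (sq_nonneg x) hx2)
        (by positivity : 0 ≤ 2 * x ^ 2)
      rw [mul_one_div] at h
      nlinarith
  have h := hmono (Set.left_mem_Icc.mpr h₀) (Set.right_mem_Icc.mpr h₀) h₀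
  simp at h
  linarith

theorem I1_le (φ : ℝ) (hφ : φ ∈ Set.Icc (0:ℝ) (4/5)) :
    I₁ φ ≤ (4 / Real.pi) * (1 / (1 + φ ^ 3)) * ((61 / 100) * φ ^ 3) := by
  obtain ⟨h₀, h₁⟩ := hφ
  unfold I₁
  rw [mul_assoc]
  refine mul_le_mul_of_nonneg_left ?_ (by positivity)
  have hA : 1104 / 1000 ≤ 2 + 2 * φ ^ 3 - 3 * φ ^ 2 := by
    nlinarith [mul_nonneg (sub_nonneg.mpr h₁) h₀,
      mul_nonneg (mul_nonneg (sub_nonneg.mpr h₁) h₀) (sub_nonneg.mpr h₁)]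
  have hB : 2 + 2 * φ ^ 3 - 4 * φ ^ 2 = (2 + 2 * φ ^ 3 - 3 * φ ^ 2) - φ ^ 2 := by ring
  rw [hB]
  generalize 2 + 2 * φ ^ 3 - 3 * φ ^ 2 = A at hA
  obtain ⟨r, hr⟩ : ∃ r, r = Real.sqrt A := ⟨_, rfl⟩
  have hr1 : 105 / 100 ≤ r := hr ▸ Real.le_sqrt_of_sq_le (by linarith)
  have hr0 : 0 < r := by linarith
  have hrA : r ^ 2 = A := hr ▸ Real.sq_sqrt (by linarith)
  rw [← hr]
  obtain ⟨s, hs⟩ : ∃ s, s = φ / r := ⟨_, rfl⟩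
  have hφs : φ = r * s := by rw [hs]; field_simp
  have hs0 : 0 ≤ s := hs ▸ by positivity
  have hs2 : s ^ 2 ≤ 58 / 100 := by
    rw [hs, div_pow, hrA, div_le_iff₀ (by linarith)]
    nlinarith
  have hroot : Real.sqrt (A - φ ^ 2) = r * Real.sqrt (1 - s ^ 2) := by
    rw [show A - φ ^ 2 = r ^ 2 * (1 - s ^ 2) by rw [hφs, ← hrA]; ring,
      Real.sqrt_mul (sq_nonneg r), Real.sqrt_sq hr0.le]
  have hg : Real.arcsin s - s * Real.sqrt (1 - s ^ 2) ≤ 885 / 1000 * s ^ 3 := by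
    have := arcsin_sub_mul_sqrt_le_s9 hs0 hs2
    have := mul_le_mul_of_nonneg_left hs2 (pow_nonneg hs0 3)
    nlinarith [pow_nonneg hs0 3]
  have h2 : Real.sqrt 2 ≤ 1415 / 1000 := Real.sqrt_le_iff.mpr (by norm_num)
  rw [← hs, hroot]
  calc Real.sqrt 2 / 2 * (A * Real.arcsin s - φ * (r * Real.sqrt (1 - s ^ 2)))
      = Real.sqrt 2 / 2 * (r ^ 2 * (Real.arcsin s - s * Real.sqrt (1 - s ^ 2))) := by
        rw [hφs, ← hrA]; ring
    _ ≤ Real.sqrt 2 / 2 * (r ^ 2 * (885 / 1000 * s ^ 3)) := by gcongr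
    _ = Real.sqrt 2 / 2 * (885 / 1000) * (r ^ 2 * s ^ 3) := by ring
    _ ≤ 61 / 100 * r * (r ^ 2 * s ^ 3) := by
        refine mul_le_mul_of_nonneg_right ?_ (by positivity)
        linarith
    _ = 61 / 100 * φ ^ 3 := by rw [hφs]; ring
end

section
/- For every φ in the half-open interval [0, 1), ∫_φ^1 s^{5/2} / √((1−s)(s² + s − φ³)) ds ≤ √(1−φ)·(4/3 + (2/3)·φ). -/
open intervalIntegral

lemma rpow_div_sqrt_le {φ s : ℝ} (h0 : 0 ≤ φ) (hs : φ < s) (h1 : s < 1) :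
    s ^ ((5:ℝ)/2) / Real.sqrt ((1 - s) * (s ^ 2 + s - φ ^ 3)) ≤ s / Real.sqrt (1 - s) := by
  have hs0 : 0 < s := h0.trans_lt hs
  have hφ3 : φ ^ 3 ≤ s ^ 3 := by gcongr
  have hkey : s ^ 3 ≤ s ^ 2 + s - φ ^ 3 := by
    nlinarith [mul_pos hs0 (mul_pos (sub_pos.2 h1) (by linarith : 0 < 2 * s + 1))]
  have hpow : s ^ ((5:ℝ)/2) = s * Real.sqrt (s ^ 3) := by
    rw [Real.sqrt_eq_rpow, ← Real.rpow_natCast, ← Real.rpow_mul hs0.le]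
    conv_rhs => rw [← Real.rpow_one_add' hs0.le (by norm_num)]
    norm_num
  have hA : 0 < Real.sqrt (1 - s) := Real.sqrt_pos.2 (sub_pos.2 h1)
  have hB : 0 < Real.sqrt (s ^ 2 + s - φ ^ 3) := Real.sqrt_pos.2 ((pow_pos hs0 3).trans_le hkey)
  rw [hpow, Real.sqrt_mul (sub_pos.2 h1).le, div_le_div_iff₀ (by positivity) hA]
  have := Real.sqrt_le_sqrt hkey
  calc s * Real.sqrt (s ^ 3) * Real.sqrt (1 - s)
      ≤ s * Real.sqrt (s ^ 2 + s - φ ^ 3) * Real.sqrt (1 - s) := by gcongr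
    _ = s * (Real.sqrt (1 - s) * Real.sqrt (s ^ 2 + s - φ ^ 3)) := by ring

lemma hasDerivAt_neg_sqrt_one_sub_mul {s : ℝ} (h1 : s < 1) :
    HasDerivAt (fun x : ℝ => -(Real.sqrt (1 - x) * (4 / 3 + (2 / 3) * x)))
      (s / Real.sqrt (1 - s)) s := by
  have hpos : 0 < 1 - s := sub_pos.2 h1
  have hA : 0 < Real.sqrt (1 - s) := Real.sqrt_pos.2 hpos
  have hsq := Real.sq_sqrt hpos.le
  have hd := ((((hasDerivAt_id s).const_sub 1).sqrt hpos.ne').mul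
    (((hasDerivAt_id s).const_mul (2 / 3 : ℝ)).const_add (4 / 3))).neg
  refine hd.congr_deriv ?_
  simp only [id]
  field_simp
  rw [hsq]
  ring

theorem integral_le_sqrt_bound (φ : ℝ) (hφ : φ ∈ Set.Ico (0:ℝ) 1) :
    (∫ s in φ..1, s ^ ((5:ℝ)/2) / Real.sqrt ((1 - s) * (s ^ 2 + s - φ ^ 3)))
      ≤ Real.sqrt (1 - φ) * (4 / 3 + (2 / 3) * φ) := by
  obtain ⟨h0, h1⟩ := hφ
  have hcont : ContinuousOn (fun x : ℝ => -(Real.sqrt (1 - x) * (4 / 3 + (2 / 3) * x)))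
      (Set.Icc φ 1) := by fun_prop
  have hint : MeasureTheory.IntegrableOn (fun s : ℝ => s / Real.sqrt (1 - s)) (Set.Ioc φ 1) :=
    integrableOn_deriv_of_nonneg hcont (fun s hs => hasDerivAt_neg_sqrt_one_sub_mul hs.2)
      fun s hs => div_nonneg (h0.trans hs.1.le) (Real.sqrt_nonneg _)
  have hval : ∫ s in φ..1, s / Real.sqrt (1 - s) = Real.sqrt (1 - φ) * (4 / 3 + (2 / 3) * φ) := by
    rw [integral_eq_sub_of_hasDerivAt_of_le h1.le hcont
      (fun s hs => hasDerivAt_neg_sqrt_one_sub_mul hs.2)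
      ((intervalIntegrable_iff_integrableOn_Ioc_of_le h1.le).2 hint)]
    simp
  rw [← hval, integral_of_le h1.le, integral_of_le h1.le]
  refine MeasureTheory.integral_mono_of_nonneg ?_ hint ?_
  · filter_upwards [MeasureTheory.ae_restrict_mem measurableSet_Ioc] with s hs
    exact div_nonneg (Real.rpow_nonneg (h0.trans hs.1.le) _) (Real.sqrt_nonneg _)
  · filter_upwards [MeasureTheory.ae_restrict_mem measurableSet_Ioc] with s hs
    rcases hs.2.lt_or_eq with h | rfl
    · exact rpow_div_sqrt_le h0 hs.1 h
    · simp
end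

section
/- The function H is strictly decreasing on the closed interval [4/5, 1]. -/
noncomputable def H (φ : ℝ) : ℝ :=
  (4 / Real.pi) * (1 / (1 + φ ^ 3)) *
    ((Real.sqrt 2 / 2) * (2 - 3 * φ ^ 2 + 2 * φ ^ 3) * Real.arcsin φ
      + Real.sqrt (1 - φ) *
        (-(φ * Real.sqrt (1 + φ - φ ^ 2)) + 4 / 3 + (2 / 3) * φ))

/-- The bracketed factor in the definition of `H`. -/
noncomputable def bracketH (φ : ℝ) : ℝ :=
  (Real.sqrt 2 / 2) * (2 - 3 * φ ^ 2 + 2 * φ ^ 3) * Real.arcsin φ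
    + Real.sqrt (1 - φ) *
      (-(φ * Real.sqrt (1 + φ - φ ^ 2)) + 4 / 3 + (2 / 3) * φ)

lemma H_eq_bracketH (φ : ℝ) :
    H φ = (4 / Real.pi) * (1 / (1 + φ ^ 3)) * bracketH φ := rfl

lemma continuous_bracketH : Continuous bracketH := by
  unfold bracketH
  have := Real.continuous_arcsin
  fun_prop

lemma hasDerivAt_bracketH {φ : ℝ} (h₀ : 0 < φ) (h₁ : φ < 1) :
    HasDerivAt bracketH
      (Real.sqrt 2 / 2 * (-6 * φ * (1 - φ)) * Real.arcsin φ
        + (Real.sqrt 2 / 2 * (2 - 3 * φ ^ 2 + 2 * φ ^ 3)) * (1 / Real.sqrt (1 - φ ^ 2))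
        + (-1 / (2 * Real.sqrt (1 - φ)) *
            (-(φ * Real.sqrt (1 + φ - φ ^ 2)) + 4 / 3 + (2 / 3) * φ)
          + Real.sqrt (1 - φ) *
            (-(Real.sqrt (1 + φ - φ ^ 2) + φ * ((1 - 2 * φ) / (2 * Real.sqrt (1 + φ - φ ^ 2))))
              + 2 / 3))) φ := by
  have hq : 1 + φ - φ ^ 2 ≠ 0 := by nlinarith
  have hu : 1 - φ ≠ 0 := by linarith
  have id' := hasDerivAt_id' φ
  have hp : HasDerivAt (fun x : ℝ => Real.sqrt 2 / 2 * (2 - 3 * x ^ 2 + 2 * x ^ 3))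
      (Real.sqrt 2 / 2 * (-6 * φ * (1 - φ))) φ := by
    refine HasDerivAt.const_mul _ ?_
    refine ((((hasDerivAt_pow 2 φ).const_mul 3).const_sub 2).add
      ((hasDerivAt_pow 3 φ).const_mul 2)).congr_deriv ?_
    norm_num
    ring
  have ha := Real.hasDerivAt_arcsin (x := φ) (by linarith) (by linarith)
  have hs : HasDerivAt (fun x : ℝ => Real.sqrt (1 - x)) (-1 / (2 * Real.sqrt (1 - φ))) φ :=
    (id'.const_sub 1).sqrt hu
  have hr : HasDerivAt (fun x : ℝ => Real.sqrt (1 + x - x ^ 2))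
      ((1 - 2 * φ) / (2 * Real.sqrt (1 + φ - φ ^ 2))) φ := by
    refine HasDerivAt.sqrt ?_ hq
    refine ((id'.const_add 1).sub (hasDerivAt_pow 2 φ)).congr_deriv ?_
    norm_num
  have hB : HasDerivAt (fun x : ℝ => -(x * Real.sqrt (1 + x - x ^ 2)) + 4 / 3 + (2 / 3) * x)
      (-(Real.sqrt (1 + φ - φ ^ 2) + φ * ((1 - 2 * φ) / (2 * Real.sqrt (1 + φ - φ ^ 2))))
        + 2 / 3) φ := by
    refine (((id'.mul hr).neg.add_const (4 / 3)).add (id'.const_mul (2 / 3))).congr_deriv ?_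
    ring
  exact (hp.mul ha).add (hs.mul hB)

lemma sqrt_one_add_sub_sq_le {φ : ℝ} (h₁ : φ ≤ 1) :
    Real.sqrt (1 + φ - φ ^ 2) ≤ 1 + (1 - φ) / 2 := by
  apply Real.sqrt_le_iff.2
  constructor <;> nlinarith [sq_nonneg (1 - φ)]

lemma deriv_bracketH_le {φ : ℝ} (h₀ : 4 / 5 < φ) (h₁ : φ < 1) :
    deriv bracketH φ ≤ Real.sqrt (1 - φ) := by
  rw [(hasDerivAt_bracketH (by linarith) h₁).deriv]
  have hfac : Real.sqrt (1 - φ ^ 2) = Real.sqrt (1 - φ) * Real.sqrt (1 + φ) := by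
    rw [← Real.sqrt_mul (by linarith)]
    congr 1
    ring
  have harc : 0 ≤ Real.arcsin φ := Real.arcsin_nonneg.2 (by linarith)
  have hr_le := sqrt_one_add_sub_sq_le h₁.le
  have hr_ge : 1 ≤ Real.sqrt (1 + φ - φ ^ 2) := Real.one_le_sqrt.2 (by nlinarith)
  have hu : 0 < Real.sqrt (1 - φ) := Real.sqrt_pos.2 (by linarith)
  have hu2 : Real.sqrt (1 - φ) ^ 2 = 1 - φ := Real.sq_sqrt (by linarith)
  have hw : 0 < Real.sqrt (1 + φ) := Real.sqrt_pos.2 (by linarith)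
  have hw2 : Real.sqrt (1 + φ) ^ 2 = 1 + φ := Real.sq_sqrt (by linarith)
  have hs0 : 0 ≤ Real.sqrt 2 := Real.sqrt_nonneg 2
  have hsw : Real.sqrt 2 / Real.sqrt (1 + φ) ≤ 1 + (1 - φ) / 2 := by
    rw [div_le_iff₀ hw]
    apply Real.sqrt_le_iff.2
    refine ⟨by nlinarith, ?_⟩
    rw [mul_pow, hw2]
    nlinarith [mul_pos (sub_pos.2 h₀) (sub_pos.2 h₁),
      mul_pos (mul_pos (sub_pos.2 h₀) (sub_pos.2 h₁)) (sub_pos.2 h₁)]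
  rw [hfac]
  generalize Real.sqrt (1 + φ - φ ^ 2) = r at *
  generalize Real.sqrt (1 - φ) = u at *
  generalize Real.sqrt (1 + φ) = w at *
  generalize Real.sqrt 2 = s at *
  generalize Real.arcsin φ = a at *
  have hfirst : s / 2 * (-6 * φ * (1 - φ)) * a ≤ 0 := by
    have : 0 ≤ s * (φ * (1 - φ)) * a := by
      have : 0 ≤ φ * (1 - φ) := by nlinarith
      positivity
    linarith
  have hpoly : 0 ≤ 2 - 3 * φ ^ 2 + 2 * φ ^ 3 ∧
      2 - 3 * φ ^ 2 + 2 * φ ^ 3 ≤ 1 + 3 / 5 * (1 - φ) := by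
    constructor <;> nlinarith [mul_pos (sub_pos.2 h₀) (sub_pos.2 h₁),
      mul_pos (mul_pos (sub_pos.2 h₁) (sub_pos.2 h₁)) (sub_pos.2 h₁), sq_nonneg (1 - φ)]
  have hsing : s / w * (2 - 3 * φ ^ 2 + 2 * φ ^ 3) ≤ 1 + 29 / 25 * (1 - φ) :=
    calc s / w * (2 - 3 * φ ^ 2 + 2 * φ ^ 3)
        ≤ (1 + (1 - φ) / 2) * (1 + 3 / 5 * (1 - φ)) :=
          mul_le_mul hsw hpoly.2 hpoly.1 (by linarith)
      _ ≤ _ := by nlinarith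
  have hB : 1 - (1 - φ) / 6 ≤ -(φ * r) + 4 / 3 + (2 / 3) * φ := by nlinarith
  have hB' : -(r + φ * ((1 - 2 * φ) / (2 * r))) + 2 / 3 ≤ 1 / 6 := by
    have : φ * ((2 * φ - 1) / (2 * r)) ≤ 1 / 2 := by
      rw [← mul_div_assoc, div_le_iff₀ (by linarith)]
      nlinarith
    have e : φ * ((1 - 2 * φ) / (2 * r)) = -(φ * ((2 * φ - 1) / (2 * r))) := by ring
    linarith
  generalize -(φ * r) + 4 / 3 + (2 / 3) * φ = B at *
  generalize -(r + φ * ((1 - 2 * φ) / (2 * r))) + 2 / 3 = B' at *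
  generalize 2 - 3 * φ ^ 2 + 2 * φ ^ 3 = p at *
  have e : s / 2 * p * (1 / (u * w)) + (-1 / (2 * u) * B + u * B')
      = (s / w * p / 2 - B / 2 + u ^ 2 * B') / u := by
    field_simp
    ring
  have : (s / w * p / 2 - B / 2 + u ^ 2 * B') / u ≤ u := by
    rw [div_le_iff₀ hu, ← sq, hu2]
    nlinarith
  linarith

lemma le_bracketH {φ : ℝ} (h₀ : 4 / 5 < φ) (h₁ : φ < 1) : 14 / 25 ≤ bracketH φ := by
  have harc : φ ≤ Real.arcsin φ := by
    have h := Real.sin_le (Real.arcsin_nonneg.2 (by linarith : 0 ≤ φ))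
    rwa [Real.sin_arcsin (by linarith) h₁.le] at h
  have hr_le := sqrt_one_add_sub_sq_le h₁.le
  have hs : 7 / 5 ≤ Real.sqrt 2 := Real.le_sqrt_of_sq_le (by norm_num)
  have hp : 1 ≤ 2 - 3 * φ ^ 2 + 2 * φ ^ 3 := by
    nlinarith [mul_nonneg (sq_nonneg (1 - φ)) (by linarith : 0 ≤ φ), sq_nonneg (1 - φ)]
  have hB : 0 ≤ -(φ * Real.sqrt (1 + φ - φ ^ 2)) + 4 / 3 + (2 / 3) * φ := by nlinarith
  have h2 := mul_nonneg (Real.sqrt_nonneg (1 - φ)) hB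
  have h3 : 7 / 10 * 1 * (4 / 5) ≤
      Real.sqrt 2 / 2 * (2 - 3 * φ ^ 2 + 2 * φ ^ 3) * Real.arcsin φ := by
    have hs' : 7 / 10 ≤ Real.sqrt 2 / 2 := by linarith
    have ha' : 4 / 5 ≤ Real.arcsin φ := by linarith
    exact mul_le_mul (mul_le_mul hs' hp (by norm_num) (by linarith)) ha' (by norm_num)
      (by positivity)
  unfold bracketH
  linarith

theorem H_strictAntiOn : StrictAntiOn H (Set.Icc (4/5 : ℝ) 1) := by
  apply strictAntiOn_of_deriv_neg (convex_Icc _ _)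
  · have : ContinuousOn
        (fun φ : ℝ => (4 / Real.pi) * (1 / (1 + φ ^ 3)) * bracketH φ) (Set.Icc (4/5 : ℝ) 1) := by
      refine ContinuousOn.mul (continuousOn_const.mul (continuousOn_const.div (by fun_prop) ?_))
        continuous_bracketH.continuousOn
      intro x hx
      have : 0 < x := by linarith [hx.1]
      positivity
    exact this
  · intro φ hφ
    rw [interior_Icc] at hφ
    obtain ⟨h₀, h₁⟩ := hφ
    have hpos : 0 < φ := by linarith
    have hden : 0 < 1 + φ ^ 3 := by positivity
    have hG := (hasDerivAt_bracketH hpos h₁).differentiableAt.hasDerivAt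
    have hD : HasDerivAt (fun x : ℝ => 1 + x ^ 3) (3 * φ ^ 2) φ := by
      simpa using (hasDerivAt_pow 3 φ).const_add 1
    have hH : HasDerivAt H (4 / Real.pi *
        ((deriv bracketH φ * (1 + φ ^ 3) - bracketH φ * (3 * φ ^ 2)) / (1 + φ ^ 3) ^ 2)) φ := by
      refine ((hG.div hD hden.ne').const_mul (4 / Real.pi)).congr_of_eventuallyEq
        (Filter.Eventually.of_forall fun x => ?_)
      simp only [H_eq_bracketH, Pi.div_apply]
      ring
    rw [hH.deriv]
    refine mul_neg_of_pos_of_neg (by positivity) (div_neg_of_neg_of_pos ?_ (by positivity))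
    have hu : Real.sqrt (1 - φ) ≤ 1 / 2 :=
      Real.sqrt_le_iff.2 ⟨by norm_num, by linarith⟩
    have hG' := deriv_bracketH_le h₀ h₁
    have hGl := le_bracketH h₀ h₁
    have hφ2 : 16 / 25 ≤ φ ^ 2 := by nlinarith
    have hφ3 : φ ^ 3 ≤ 1 := pow_le_one₀ hpos.le h₁.le
    have a1 : deriv bracketH φ * (1 + φ ^ 3) ≤ 1 / 2 * 2 := by
      calc _ ≤ 1 / 2 * (1 + φ ^ 3) := by gcongr; linarith
        _ ≤ _ := by linarith
    have a2 : 14 / 25 * (3 * (16 / 25)) ≤ bracketH φ * (3 * φ ^ 2) := by gcongr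
    linarith
end

section
/- For every φ in the closed interval [4/5, 1], H(φ) < 1. In particular H(4/5) < 0.9881. -/
/-- The Taylor polynomial of degree seven is a lower bound for `arcsin` on `[0, 1)`. -/
lemma taylor_le_arcsin {x : ℝ} (hx0 : 0 ≤ x) (hx1 : x < 1) :
    x + x ^ 3 / 6 + 3 * x ^ 5 / 40 + 5 * x ^ 7 / 112 ≤ Real.arcsin x := by
  let f : ℝ → ℝ := fun y => Real.arcsin y - (y + y ^ 3 / 6 + 3 * y ^ 5 / 40 + 5 * y ^ 7 / 112)
  have hmono : MonotoneOn f (Set.Ico 0 1) := by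
    refine monotoneOn_of_hasDerivWithinAt_nonneg (convex_Ico 0 1)
      (f' := fun y => 1 / Real.sqrt (1 - y ^ 2)
        - (1 + y ^ 2 / 2 + 3 * y ^ 4 / 8 + 5 * y ^ 6 / 16)) ?_ ?_ ?_
    · have := Real.continuous_arcsin
      fun_prop
    · intro y hy
      rw [interior_Ico] at hy
      have h1 := Real.hasDerivAt_arcsin (x := y) (by linarith [hy.1]) (by linarith [hy.2])
      have h2 := ((((hasDerivAt_id y).add (((hasDerivAt_id y).pow 3).div_const 6)).add
        ((((hasDerivAt_id y).pow 5).const_mul 3).div_const 40)).add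
        ((((hasDerivAt_id y).pow 7).const_mul 5).div_const 112))
      refine ((h1.sub h2).congr_deriv ?_).hasDerivWithinAt
      simp only [id]
      ring
    · intro y hy
      rw [interior_Ico] at hy
      obtain ⟨hy0, hy1⟩ := hy
      have hpos : 0 < 1 - y ^ 2 := by nlinarith
      have hs := Real.sqrt_pos.mpr hpos
      rw [sub_nonneg, le_div_iff₀ hs]
      refine le_of_sq_le_sq ?_ zero_le_one
      rw [mul_pow, Real.sq_sqrt hpos.le]
      have : 0 ≤ 35 * y ^ 8 / 64 + 7 * y ^ 10 / 32 + 35 * y ^ 12 / 256 + 25 * y ^ 14 / 256 := by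
        positivity
      nlinarith
  have h := hmono (Set.left_mem_Ico.mpr one_pos) ⟨hx0, hx1⟩ hx0
  simp only [f, Real.arcsin_zero] at h
  linarith

lemma arcsin_one_sub_two_mul_sq {w : ℝ} (hw0 : 0 ≤ w) (hw1 : w ≤ 1) :
    Real.arcsin (1 - 2 * w ^ 2) = Real.pi / 2 - 2 * Real.arcsin w := by
  have h0 := Real.arcsin_nonneg.mpr hw0
  have h1 := Real.arcsin_le_pi_div_two w
  apply Real.arcsin_eq_of_sin_eq
  · rw [Real.sin_pi_div_two_sub, Real.cos_two_mul, Real.cos_sq',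
      Real.sin_arcsin (by linarith) hw1]
    ring
  · constructor <;> linarith

lemma sqrt_two_mul_arcsin_one_sub_sq_le {s : ℝ} (hs0 : 0 ≤ s) (hs1 : s ≤ 1) :
    Real.sqrt 2 / 2 * Real.arcsin (1 - s ^ 2) ≤ Real.sqrt 2 * Real.pi / 4
      - s * (1 + s ^ 2 / 12 + 3 * s ^ 4 / 160 + 5 * s ^ 6 / 896) := by
  obtain ⟨r, hr⟩ : ∃ r, r = Real.sqrt 2 := ⟨_, rfl⟩
  have hr2 : r ^ 2 = 2 := by rw [hr]; norm_num
  have hr0 : 0 ≤ r := by rw [hr]; positivity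
  obtain ⟨w, hw⟩ : ∃ w, w = r * s / 2 := ⟨_, rfl⟩
  have hw0 : 0 ≤ w := by rw [hw]; positivity
  have hw2 : w ^ 2 = s ^ 2 / 2 := by rw [hw, div_pow, mul_pow, hr2]; ring
  have hw1 : w < 1 := by nlinarith
  have hrw : r * w = s := by
    rw [hw]
    linear_combination s / 2 * hr2
  have h := mul_le_mul_of_nonneg_left (taylor_le_arcsin hw0 hw1) hr0
  have hpoly : r * (w + w ^ 3 / 6 + 3 * w ^ 5 / 40 + 5 * w ^ 7 / 112)
      = s * (1 + s ^ 2 / 12 + 3 * s ^ 4 / 160 + 5 * s ^ 6 / 896) := by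
    calc _ = r * w * (1 + w ^ 2 / 6 + 3 * (w ^ 2) ^ 2 / 40 + 5 * (w ^ 2) ^ 3 / 112) := by ring
      _ = _ := by rw [hrw, hw2]; ring
  rw [← hr, show 1 - s ^ 2 = 1 - 2 * w ^ 2 by rw [hw2]; ring,
    arcsin_one_sub_two_mul_sq hw0 hw1.le]
  linarith

lemma H_lt_of_lt {φ c : ℝ} (hφ : 0 ≤ φ)
    (h : 4 * ((Real.sqrt 2 / 2) * (2 - 3 * φ ^ 2 + 2 * φ ^ 3) * Real.arcsin φ
      + Real.sqrt (1 - φ) * (-(φ * Real.sqrt (1 + φ - φ ^ 2)) + 4 / 3 + (2 / 3) * φ))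
      < c * (Real.pi * (1 + φ ^ 3))) : H φ < c := by
  have hp := Real.pi_pos
  have hq : 0 < 1 + φ ^ 3 := by positivity
  rw [← div_lt_iff₀ (by positivity)] at h
  refine lt_of_eq_of_lt ?_ h
  unfold H
  field_simp

lemma H_four_fifths_lt : H (4/5) < 0.9881 := by
  apply H_lt_of_lt (by norm_num)
  obtain ⟨s, hs⟩ : ∃ s, s = Real.sqrt (1 - 4 / 5) := ⟨_, rfl⟩
  have hs0 : 0 ≤ s := by rw [hs]; positivity
  have hs2 : s ^ 2 = 1 / 5 := by rw [hs, Real.sq_sqrt] <;> norm_num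
  have hs_lo : 0.447213 < s := by nlinarith
  have harc := sqrt_two_mul_arcsin_one_sub_sq_le hs0 (by nlinarith)
  rw [show s ^ 4 = (s ^ 2) ^ 2 by ring, show s ^ 6 = (s ^ 2) ^ 3 by ring, hs2] at harc
  norm_num only at harc
  have hq : 1.07703 ≤ Real.sqrt (1 + 4 / 5 - (4 / 5) ^ 2) := by
    apply Real.le_sqrt_of_sq_le
    norm_num
  have hr : Real.sqrt 2 < 1.414214 := by
    rw [Real.sqrt_lt' (by norm_num)]
    norm_num
  have hpi := Real.pi_lt_d6
  have hpi' := Real.pi_gt_d6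
  rw [← hs]
  have h1 := mul_le_mul_of_nonneg_left hq hs0
  have h2 := mul_lt_mul_of_pos_right hr Real.pi_pos
  nlinarith

theorem H_lt_one : (∀ φ ∈ Set.Icc (4/5 : ℝ) 1, H φ < 1) ∧ H (4/5) < 0.9881 := by
  refine ⟨fun φ hφ => ?_, H_four_fifths_lt⟩
  obtain ⟨hφ0, hφ1⟩ := hφ
  apply H_lt_of_lt (by linarith)
  obtain ⟨u, rfl⟩ : ∃ u, φ = 1 - u := ⟨1 - φ, by ring⟩
  have hu0 : 0 ≤ u := by linarith
  have hu1 : u ≤ 1 / 5 := by linarith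
  rw [sub_sub_cancel]
  obtain ⟨s, hs⟩ : ∃ s, s = Real.sqrt u := ⟨_, rfl⟩
  have hs0 : 0 ≤ s := by rw [hs]; positivity
  have hs2 : s ^ 2 = u := by rw [hs, Real.sq_sqrt hu0]
  have hs1 : s ≤ 0.4473 := by nlinarith
  have harc : Real.sqrt 2 / 2 * Real.arcsin (1 - u)
      ≤ Real.sqrt 2 * Real.pi / 4 - s * (1 + u / 12) := by
    have h := sqrt_two_mul_arcsin_one_sub_sq_le hs0 (by linarith)
    rw [hs2] at h
    have : 0 ≤ s * (3 * s ^ 4 / 160 + 5 * s ^ 6 / 896) := by positivity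
    linarith
  have hq : 1 + 0.48 * (u * (1 - u)) ≤ Real.sqrt (1 + (1 - u) - (1 - u) ^ 2) := by
    apply Real.le_sqrt_of_sq_le
    have h0 : 0 ≤ u * (1 - u) := mul_nonneg hu0 (by linarith)
    have h1 : u * (1 - u) ≤ 0.16 := by nlinarith
    nlinarith
  have hr : Real.sqrt 2 < 1.41422 := by
    rw [Real.sqrt_lt' (by norm_num)]
    norm_num
  rw [← hs]
  have hP : 0 < 1 + 3 * u ^ 2 - 2 * u ^ 3 := by nlinarith [sq_nonneg u]
  have h1 := mul_le_mul_of_nonneg_left harc hP.le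
  have h2 := mul_le_mul_of_nonneg_left hq (mul_nonneg hs0 (by linarith : 0 ≤ 1 - u))
  have h3 := mul_lt_mul_of_pos_left hr (mul_pos Real.pi_pos hP)
  have hu2 : 0 ≤ u ^ 2 := by positivity
  obtain ⟨R, hR⟩ : ∃ R, R = 0.48 * (1 - u) ^ 2 - 1 / 4 + 3 * u - 2 * u ^ 2
    + (3 * u ^ 2 - 2 * u ^ 3) / 12 := ⟨_, rfl⟩
  obtain ⟨A, hA⟩ : ∃ A, A = 1.41422 * (1 + 3 * u ^ 2 - 2 * u ^ 3) - (1 + (1 - u) ^ 3) := ⟨_, rfl⟩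
  have hR0 : 0 ≤ R := by rw [hR]; nlinarith [mul_nonneg hu2 (by linarith : 0 ≤ 1 / 5 - u)]
  have hsu : 2.235 * u ≤ s := by nlinarith
  have hbound : 3.1416 * A ≤ 4 * (2.235 * u) * u * R := by
    rw [hA, hR]
    nlinarith [mul_nonneg hu2 (by linarith : 0 ≤ 1 / 5 - u),
      mul_nonneg hu0 (by linarith : 0 ≤ 1 / 5 - u), mul_nonneg hu2 hu2,
      mul_nonneg (mul_nonneg hu2 hu2) (by linarith : 0 ≤ 1 / 5 - u),
      mul_nonneg (mul_nonneg hu2 hu0) (by linarith : 0 ≤ 1 / 5 - u)]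
  have hsR : 4 * (2.235 * u) * u * R ≤ 4 * s * u * R := by gcongr
  have hmain : Real.pi * A ≤ 4 * s * u * R := by
    rcases le_or_gt A 0 with h | h
    · have h4 := mul_nonneg Real.pi_pos.le (neg_nonneg.mpr h)
      have : 0 ≤ 4 * s * u * R := by positivity
      linarith
    · have := mul_lt_mul_of_pos_right Real.pi_lt_d4 h
      linarith
  rw [hA, hR] at hmain
  linarith
end

section
/- For every φ in the closed interval [1/2, 1], J(φ) ≤ (2/3 + 2√2)·(1 − φ). -/
noncomputable def J (φ : ℝ) : ℝ :=
  -4 / 3 - (2 / 3) * φ + φ * (4 * φ - 3 * φ ^ 2) / Real.sqrt (1 + φ - φ ^ 2)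
    + Real.sqrt 2 * (2 - 3 * φ ^ 2 + 2 * φ ^ 3) / Real.sqrt (1 + φ)

theorem J_le (φ : ℝ) (hφ : φ ∈ Set.Icc (1/2 : ℝ) 1) :
    J φ ≤ (2 / 3 + 2 * Real.sqrt 2) * (1 - φ) := by
  obtain ⟨h0, h1⟩ := hφ
  have first_term : φ * (4 * φ - 3 * φ ^ 2) / Real.sqrt (1 + φ - φ ^ 2)
      ≤ φ * (4 * φ - 3 * φ ^ 2) := by
    have hs : 1 ≤ Real.sqrt (1 + φ - φ ^ 2) := Real.one_le_sqrt.2 (by nlinarith)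
    exact div_le_self (mul_nonneg (by linarith) (by nlinarith)) hs
  have sqrt_ratio : Real.sqrt 2 / Real.sqrt (1 + φ) ≤ (4 - φ) / 3 := by
    rw [← Real.sqrt_div zero_le_two]
    refine Real.sqrt_le_iff.2 ⟨by linarith, ?_⟩
    rw [div_le_iff₀ (by linarith)]
    nlinarith [mul_nonneg (sub_nonneg.2 h0) (sub_nonneg.2 h1),
      mul_nonneg (mul_nonneg (sub_nonneg.2 h0) (sub_nonneg.2 h1)) (sub_nonneg.2 h1)]
  have second_term : Real.sqrt 2 * (2 - 3 * φ ^ 2 + 2 * φ ^ 3) / Real.sqrt (1 + φ)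
      ≤ (4 - φ) / 3 * (2 - 3 * φ ^ 2 + 2 * φ ^ 3) := by
    rw [mul_div_right_comm]
    exact mul_le_mul_of_nonneg_right sqrt_ratio
      (by nlinarith [mul_nonneg (sq_nonneg (1 - φ)) (by linarith : 0 ≤ 1 + 2 * φ)])
  have sqrt_two : 1 ≤ Real.sqrt 2 := Real.one_le_sqrt.2 one_le_two
  have cube_le_one : φ ^ 3 ≤ 1 := pow_le_one₀ (by linarith) h1
  have polynomial_bound : -4 / 3 - (2 / 3) * φ + φ * (4 * φ - 3 * φ ^ 2)
      + (4 - φ) / 3 * (2 - 3 * φ ^ 2 + 2 * φ ^ 3) ≤ (2 / 3 + 2 * Real.sqrt 2) * (1 - φ) :=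
    calc
      _ = (4 / 3 + 2 / 3 * φ ^ 3) * (1 - φ) := by ring
      _ ≤ _ := mul_le_mul_of_nonneg_right (by linarith) (sub_nonneg.2 h1)
  unfold J
  linarith
end

section
/- For every φ in the closed interval [4/5, 1], K(φ) ≤ −11/12. More precisely, K(φ) ≤ −1 + (1/6)·(1 − φ) for all φ ∈ [0, 1]. -/
noncomputable def K (φ : ℝ) : ℝ :=
  -4 / 3 - (2 / 3) * φ + φ * Real.sqrt (1 + φ - φ ^ 2)

/-- The squared form of the bound is the identity
`(1 + φ)² - 4φ²(1 + φ - φ²) = ((φ - 1)(2φ + 1))²`. -/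
theorem mul_sqrt_one_add_sub_sq_le {φ : ℝ} (h0 : 0 ≤ φ) (h1 : φ ≤ 1) :
    φ * Real.sqrt (1 + φ - φ ^ 2) ≤ (1 + φ) / 2 := by
  have hs : 0 ≤ 1 + φ - φ ^ 2 := by nlinarith
  refine (abs_le_of_sq_le_sq' ?_ (by linarith)).2
  rw [mul_pow, Real.sq_sqrt hs]
  linarith [sq_nonneg ((φ - 1) * (2 * φ + 1))]

theorem K_le : (∀ φ ∈ Set.Icc (4/5 : ℝ) 1, K φ ≤ -11 / 12) ∧
    (∀ φ ∈ Set.Icc (0:ℝ) 1, K φ ≤ -1 + (1 / 6) * (1 - φ)) := by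
  have key : ∀ φ ∈ Set.Icc (0:ℝ) 1, K φ ≤ -1 + (1 / 6) * (1 - φ) := by
    rintro φ ⟨h0, h1⟩
    unfold K
    linarith [mul_sqrt_one_add_sub_sq_le h0 h1]
  refine ⟨?_, key⟩
  rintro φ ⟨h0, h1⟩
  linarith [key φ ⟨by linarith, h1⟩]
end
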